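/- Let R = k[t,t⁻¹] over a field k, and let M be a finitely generated R-module. Then Ext¹_R(M, R) is isomorphic as an R-module to the k-linear dual of Tors_R M with the conjugate module structure: t acts on Hom_k(Tors_R M, k) by (t·φ)(x) = φ(t⁻¹·x) up to the identification R → R, t ↦ t⁻¹. -/

import Mathlib

open CategoryTheory Opposite LaurentPolynomial

theorem laurent_pid (k : Type) [Field k] : IsPrincipalIdealRing k[T;T⁻¹] := by
  refine ⟨fun I => ?_⟩
  have h := IsLocalization.map_under (Submonoid.powers (Polynomial.X : Polynomial k)) k[T;T⁻¹] I
  have hp := (IsPrincipalIdealRing.principal (I.comap (algebraMap (Polynomial k) k[T;T⁻¹])))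
  rw [← h]
  exact inferInstance

theorem laurent_fin (k : Type) [Field k] (q : k[T;T⁻¹]) (hq : q ≠ 0) :
    Module.Finite k (k[T;T⁻¹] ⧸ (k[T;T⁻¹] ∙ q)) := by
  have : Algebra.FiniteType k k[T;T⁻¹] := inferInstance
  have := laurent_pid k
  have : IsArtinianRing (k[T;T⁻¹] ⧸ (Ideal.span {q})) := by
    rw [isArtinianRing_iff_krullDimLE_zero]
    refine Ring.KrullDimLE.mk₀ fun I hI => ?_
    have hsurj : Function.Surjective (Ideal.Quotient.mk (Ideal.span {q})) :=
      Ideal.Quotient.mk_surjective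
    have h1 : (I.comap (Ideal.Quotient.mk (Ideal.span {q}))).IsPrime := inferInstance
    have h2 : I.comap (Ideal.Quotient.mk (Ideal.span {q})) ≠ ⊥ := by
      intro h
      apply hq
      have : q ∈ I.comap (Ideal.Quotient.mk (Ideal.span {q})) := by
        rw [Ideal.mem_comap, Ideal.Quotient.eq_zero_iff_mem.2 (Ideal.mem_span_singleton_self q)]
        exact I.zero_mem
      rw [h] at this
      exact this
    have h3 := IsPrime.to_maximal_ideal h2
    rw [← Ideal.map_comap_of_surjective _ hsurj I]
    rcases Ideal.map_eq_top_or_isMaximal_of_surjective _ hsurj h3 with h | h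
    · rw [Ideal.map_comap_of_surjective _ hsurj I] at h
      exact absurd h hI.ne_top
    · exact h
  exact Module.finite_of_isArtinianRing k (k[T;T⁻¹] ⧸ (Ideal.span {q}))

theorem exists_dvd_mul_sub {R : Type} [CommRing R] [IsDomain R] [IsPrincipalIdealRing R]
    {p : R} (hp : Irreducible p) (e : ℕ) (a : R) (ha : ¬ p ^ (e + 1) ∣ a) :
    ∃ b, p ^ (e + 1) ∣ a * b - p ^ e := by
  have hfin : FiniteMultiplicity p a := by
    by_contra h
    rw [FiniteMultiplicity.not_iff_forall] at h
    exact ha (h _)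
  obtain ⟨c, hc, hpc⟩ := hfin.exists_eq_pow_mul_and_not_dvd
  set j := multiplicity p a
  have hj : j ≤ e := by
    by_contra hlt
    exact ha (hc ▸ Dvd.dvd.mul_right (pow_dvd_pow p (by omega)) c)
  have hcop : IsCoprime p c := (hp.coprime_iff_not_dvd).2 hpc
  obtain ⟨u, v, huv⟩ := hcop
  refine ⟨v * p ^ (e - j), -u, ?_⟩
  have : p ^ e = p ^ j * p ^ (e - j) := by rw [← pow_add]; congr 1; omega
  rw [hc, pow_succ, this]
  linear_combination (p ^ j * p ^ (e - j)) * huv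

theorem frob_surj {k R Q : Type} [Field k] [CommRing R] [Algebra k R] [AddCommGroup Q]
    [Module R Q] [Module k Q] [IsScalarTower k R Q] [Module.Finite k Q]
    (mk : R →ₗ[R] Q) (hmk : Function.Surjective mk) (l : Q →ₗ[k] k)
    (h : ∀ a : R, (∀ x, l (a • x) = 0) → mk a = 0) (f : Q →ₗ[k] k) :
    ∃ a : R, ∀ x, f x = l (a • x) := by
  let F : R →ₗ[k] (Q →ₗ[k] k) :=
    { toFun := fun a => l ∘ₗ (Algebra.lsmul k k Q a)
      map_add' := fun a b => by ext x; simp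
      map_smul' := fun c b => by ext x; simp }
  have hF : ∀ a x, F a x = l (a • x) := fun a x => rfl
  have hker : LinearMap.ker F = LinearMap.ker (mk.restrictScalars k) := by
    ext a
    rw [LinearMap.mem_ker, LinearMap.mem_ker]
    constructor
    · intro ha
      exact h a fun x => by rw [← hF, ha]; rfl
    · intro ha
      have ha' : mk a = 0 := ha
      ext x
      obtain ⟨y, rfl⟩ := hmk x
      rw [hF, ← map_smul, smul_eq_mul, mul_comm, ← smul_eq_mul, map_smul, ha']
      simp
  have e : LinearMap.range F ≃ₗ[k] Q :=
    (F.quotKerEquivRange).symm ≪≫ₗ (Submodule.quotEquivOfEq _ _ hker) ≪≫ₗ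
      (LinearMap.quotKerEquivOfSurjective (mk.restrictScalars k) hmk)
  have htop : LinearMap.range F = ⊤ := by
    apply Submodule.eq_top_of_finrank_eq
    rw [e.finrank_eq]
    exact (Subspace.dual_finrank_eq (K := k) (V := Q)).symm
  obtain ⟨a, ha⟩ := LinearMap.range_eq_top.1 htop f
  exact ⟨a, fun x => by rw [← ha, hF]⟩

theorem exists_frob (k : Type) [Field k] (p : k[T;T⁻¹]) (hp : Irreducible p) (e : ℕ) :
    ∃ l : (k[T;T⁻¹] ⧸ (k[T;T⁻¹] ∙ p ^ e)) →ₗ[k] k,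
      (∀ a : k[T;T⁻¹], (∀ x, l (a • x) = 0) → p ^ e ∣ a) ∧
      ∀ f : (k[T;T⁻¹] ⧸ (k[T;T⁻¹] ∙ p ^ e)) →ₗ[k] k, ∃ a : k[T;T⁻¹], ∀ x, f x = l (a • x) := by
  have := laurent_pid k
  rcases e with _ | e
  · have hs : Subsingleton (k[T;T⁻¹] ⧸ (k[T;T⁻¹] ∙ p ^ 0)) := by
      rw [pow_zero, Submodule.Quotient.subsingleton_iff]
      exact Ideal.span_singleton_one
    refine ⟨0, fun a _ => by simp, fun f => ⟨0, fun x => ?_⟩⟩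
    rw [Subsingleton.elim x 0]; simp
  have hfin := laurent_fin k (p ^ (e + 1)) (pow_ne_zero _ hp.ne_zero)
  have hmk : ∀ a : k[T;T⁻¹],
      (Submodule.Quotient.mk a : k[T;T⁻¹] ⧸ (k[T;T⁻¹] ∙ p ^ (e + 1))) = 0 ↔ p ^ (e + 1) ∣ a := by
    intro a
    rw [Submodule.Quotient.mk_eq_zero]
    exact Ideal.mem_span_singleton
  have hne : (Submodule.Quotient.mk (p ^ e) : k[T;T⁻¹] ⧸ (k[T;T⁻¹] ∙ p ^ (e + 1))) ≠ 0 := by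
    rw [Ne, hmk, pow_dvd_pow_iff hp.ne_zero hp.not_isUnit]
    omega
  obtain ⟨l, hl⟩ : ∃ l : Module.Dual k (k[T;T⁻¹] ⧸ (k[T;T⁻¹] ∙ p ^ (e + 1))),
      l (Submodule.Quotient.mk (p ^ e)) ≠ 0 := by
    by_contra! h
    exact hne ((Module.forall_dual_apply_eq_zero_iff k _).1 h)
  have key : ∀ a : k[T;T⁻¹], (∀ x, l (a • x) = 0) → p ^ (e + 1) ∣ a := by
    intro a h
    by_contra hna
    obtain ⟨b, hb⟩ := exists_dvd_mul_sub hp e a hna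
    apply hl
    have h1 := h (Submodule.Quotient.mk b)
    rw [← hmk, Submodule.Quotient.mk_sub, sub_eq_zero] at hb
    rw [← hb]
    exact h1
  refine ⟨l, key, ?_⟩
  refine frob_surj (Submodule.mkQ (k[T;T⁻¹] ∙ p ^ (e + 1))) (Submodule.mkQ_surjective _) l ?_
  intro a h
  exact (hmk a).2 (key a h)

section
variable {R : Type} [CommRing R] {P1 P0 M : Type} [AddCommGroup P1] [AddCommGroup P0]
  [AddCommGroup M] [Module R P1] [Module R P0] [Module R M]

noncomputable def twoTerm (d : P1 →ₗ[R] P0) : ChainComplex (ModuleCat.{0} R) ℕ :=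
  ChainComplex.mk' (ModuleCat.of R P0) (ModuleCat.of R P1) (ModuleCat.ofHom d)
    (fun _ => ⟨ModuleCat.of R PUnit, 0, by simp⟩)

theorem twoTerm_d_1_0 (d : P1 →ₗ[R] P0) : (twoTerm d).d 1 0 = ModuleCat.ofHom d := by
  simp [twoTerm]

theorem twoTerm_isZero (d : P1 →ₗ[R] P0) (n : ℕ) : Limits.IsZero ((twoTerm d).X (n + 2)) := by
  obtain (_ | _ | n) := n
  all_goals exact ModuleCat.isZero_of_subsingleton (ModuleCat.of R PUnit)

theorem twoTerm_exactAt (d : P1 →ₗ[R] P0) (hd : Function.Injective d) (n : ℕ) :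
    (twoTerm d).ExactAt (n + 1) := by
  rw [HomologicalComplex.exactAt_iff' _ (n + 1 + 1) (n + 1) n (by simp) (by simp)]
  cases n with
  | zero =>
    rw [ShortComplex.exact_iff_mono]
    · change Mono ((twoTerm d).d 1 0)
      rw [twoTerm_d_1_0]
      exact (ModuleCat.mono_iff_injective _).2 hd
    · exact (twoTerm_isZero d 0).eq_of_src _ _
  | succ n => exact ShortComplex.exact_of_isZero_X₂ _ (twoTerm_isZero d n)

noncomputable def twoTermRes (d : P1 →ₗ[R] P0) (π : P0 →ₗ[R] M) (hd : Function.Injective d)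
    (hex : Function.Exact d π) (hπ : Function.Surjective π) [Module.Projective R P1]
    [Module.Projective R P0] : ProjectiveResolution (ModuleCat.of R M) where
  complex := twoTerm d
  projective n := by
    obtain (_ | _ | n) := n
    · exact (IsProjective.iff_projective P0).1 inferInstance
    · exact (IsProjective.iff_projective P1).1 inferInstance
    · exact (twoTerm_isZero d n).projective
  π := (ChainComplex.toSingle₀Equiv _ _).symm ⟨ModuleCat.ofHom π, by
    rw [twoTerm_d_1_0]; ext x; exact hex.apply_apply_eq_zero x⟩
  quasiIso := ⟨fun n => by
    cases n with
    | zero =>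
      rw [ChainComplex.quasiIsoAt₀_iff, ShortComplex.quasiIso_iff_of_zeros']
      · refine (ShortComplex.exact_and_epi_g_iff_of_iso (S₂ := ShortComplex.mk
          (ModuleCat.ofHom d) (ModuleCat.ofHom π)
            (by ext x; exact hex.apply_apply_eq_zero x)) ?_).2 ⟨?_, ?_⟩
        · exact ShortComplex.isoMk (Iso.refl _) (Iso.refl _) (Iso.refl _)
            (by
              simp only [Iso.refl_hom]
              erw [Category.id_comp])
            (by
              simp only [Iso.refl_hom]
              erw [Category.id_comp])
        · exact ModuleCat.shortComplex_exact _ hex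
        · exact (ModuleCat.epi_iff_surjective _).2 hπ
      all_goals rfl
    | succ n =>
      rw [quasiIsoAt_iff_exactAt']
      · exact twoTerm_exactAt d hd n
      · apply ChainComplex.exactAt_succ_single_obj⟩

theorem ext_one_two_term (d : P1 →ₗ[R] P0) (π : P0 →ₗ[R] M) (hd : Function.Injective d)
    (hex : Function.Exact d π) (hπ : Function.Surjective π) [Module.Projective R P1]
    [Module.Projective R P0] (N : Type) [AddCommGroup N] [Module R N] :
    Nonempty (((Ext R (ModuleCat.{0} R) 1).obj (op (ModuleCat.of R M))).obj (ModuleCat.of R N)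
      ≃ₗ[R] ((P1 →ₗ[R] N) ⧸ LinearMap.range (LinearMap.lcomp R N d))) := by
  let P := twoTermRes d π hd hex hπ
  let K := P.complex.linearYonedaObj R (ModuleCat.of R N)
  let S := K.sc' 0 1 2
  let i1 := (P.isoExt (R := R) 1 (ModuleCat.of R N))
  let i2 : K.homology 1 ≅ S.homology := ShortComplex.homologyMapIso (K.isoSc' 0 1 2 (by simp) (by simp))
  let i3 := S.moduleCatHomologyIso
  have hker : LinearMap.ker S.g.hom = ⊤ := by
    rw [eq_top_iff]
    intro x _
    rw [LinearMap.mem_ker]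
    exact (twoTerm_isZero d 0).eq_of_src _ _
  let e : (P1 →ₗ[R] N) ≃ₗ[R] LinearMap.ker S.g.hom :=
    (ModuleCat.homLinearEquiv (S := R) (M := ModuleCat.of R P1) (N := ModuleCat.of R N)).symm ≪≫ₗ
      (LinearEquiv.ofTop _ hker).symm
  have hmap : (LinearMap.range (LinearMap.lcomp R N d)).map e.toLinearMap =
      LinearMap.range S.moduleCatToCycles := by
    have hf : ∀ g : P0 →ₗ[R] N, S.moduleCatToCycles (ModuleCat.ofHom g : ModuleCat.of R P0 ⟶ ModuleCat.of R N) = e (LinearMap.lcomp R N d g) := by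
      intro g
      apply Subtype.ext
      change (twoTerm d).d 1 0 ≫ (ModuleCat.ofHom g : ModuleCat.of R P0 ⟶ ModuleCat.of R N) = ModuleCat.ofHom (g ∘ₗ d)
      rw [twoTerm_d_1_0]
      rfl
    apply le_antisymm
    · rintro _ ⟨_, ⟨g, rfl⟩, rfl⟩
      exact ⟨_, hf g⟩
    · rintro _ ⟨g, rfl⟩
      let g' : ModuleCat.of R P0 ⟶ ModuleCat.of R N := g
      exact ⟨_, ⟨g'.hom, rfl⟩, (hf g'.hom).symm⟩
  exact ⟨(i1 ≪≫ i2 ≪≫ i3).toLinearEquiv ≪≫ₗ (Submodule.Quotient.equiv _ _ e hmap).symm⟩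
end

set_option maxHeartbeats 1000000 in
theorem ext_one_aux
    (k : Type) [Field k] (M : Type) [AddCommGroup M]
    [Module k[T;T⁻¹] M] [Module k M]
    [IsScalarTower k k[T;T⁻¹] M]
    (n : ℕ) (ι : Type) [Fintype ι] [DecidableEq ι] (Q : ι → Type) [∀ i, AddCommGroup (Q i)]
    [∀ i, Module k[T;T⁻¹] (Q i)] [∀ i, Module k (Q i)] [∀ i, IsScalarTower k k[T;T⁻¹] (Q i)]
    (q : ι → k[T;T⁻¹]) (hq : ∀ i, q i ≠ 0)
    (mk : ∀ i, k[T;T⁻¹] →ₗ[k[T;T⁻¹]] Q i) (hmk : ∀ i, Function.Surjective (mk i))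
    (hmk0 : ∀ i a, mk i a = 0 ↔ q i ∣ a)
    (l : ∀ i, Q i →ₗ[k] k)
    (hl : ∀ i a, (∀ x, l i (a • x) = 0) → q i ∣ a)
    (hs : ∀ i (f : Q i →ₗ[k] k), ∃ a : k[T;T⁻¹], ∀ x, f x = l i (a • x))
    (G : M ≃ₗ[k[T;T⁻¹]] (Fin n →₀ k[T;T⁻¹]) × (∀ i, Q i)) :
    ∃ e : ((Ext (LaurentPolynomial k) (ModuleCat (LaurentPolynomial k)) 1).obj
        (op (ModuleCat.of (LaurentPolynomial k) M))).obj
          (ModuleCat.of (LaurentPolynomial k) (LaurentPolynomial k)) ≃+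
        (↥(Submodule.torsion (LaurentPolynomial k) M) →ₗ[k] k),
      (∀ (c : k) (x), e ((C c : LaurentPolynomial k) • x) = c • e x) ∧
      (∀ (x) (v : ↥(Submodule.torsion (LaurentPolynomial k) M)),
        e ((T 1 : LaurentPolynomial k) • x) v
          = e x ((T 1 : LaurentPolynomial k) • v)) := by
  let R := k[T;T⁻¹]
  let d : (ι → R) →ₗ[R] (Fin n →₀ R) × (ι → R) :=
    LinearMap.inr R _ _ ∘ₗ LinearMap.pi (fun i => q i • LinearMap.proj i)
  have hd1 : ∀ f, (d f).1 = 0 := fun f => rfl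
  have hd2 : ∀ f i, (d f).2 i = q i * f i := fun f i => rfl
  let π : (Fin n →₀ R) × (ι → R) →ₗ[R] M :=
    G.symm.toLinearMap ∘ₗ LinearMap.prodMap LinearMap.id
      (LinearMap.pi fun i => mk i ∘ₗ LinearMap.proj i)
  have hπ : ∀ x, π x = G.symm (x.1, fun i => mk i (x.2 i)) := fun x => rfl
  have hdinj : Function.Injective d := by
    intro f g h
    funext i
    apply mul_left_cancel₀ (hq i)
    rw [← hd2, ← hd2, h]
  have hsurj : Function.Surjective π := by
    intro m
    choose y hy using fun i => hmk i ((G m).2 i)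
    refine ⟨((G m).1, y), ?_⟩
    rw [hπ]
    simp only [hy]
    exact G.symm_apply_apply m
  have hex : Function.Exact d π := by
    rintro ⟨x, y⟩
    rw [hπ, LinearEquiv.map_eq_zero_iff, Prod.mk_eq_zero]
    constructor
    · rintro ⟨hx, hy⟩
      have hy' : ∀ i, q i ∣ y i := fun i => (hmk0 i _).1 (congrFun hy i)
      choose z hz using hy'
      refine ⟨z, Prod.ext hx.symm (funext fun i => ?_)⟩
      rw [hd2]
      exact (hz i).symm
    · rintro ⟨z, hz⟩
      rw [← hz]
      refine ⟨rfl, funext fun i => ?_⟩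
      exact (hmk0 i _).2 ⟨z i, rfl⟩
  obtain ⟨e0⟩ := ext_one_two_term d π hdinj hex hsurj R
  -- coordinates on the torsion submodule
  let h : ∀ i, Submodule.torsion R M →ₗ[R] Q i := fun i =>
    LinearMap.proj i ∘ₗ LinearMap.snd R _ _ ∘ₗ G.toLinearMap ∘ₗ (Submodule.torsion R M).subtype
  have hh : ∀ i v, h i v = (G v.1).2 i := fun i v => rfl
  have htor : ∀ i (x : Q i), q i • x = 0 := by
    intro i x
    obtain ⟨y, rfl⟩ := hmk i x
    rw [← map_smul, hmk0]
    exact ⟨y, rfl⟩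
  let s : ∀ i, Q i →ₗ[R] Submodule.torsion R M := fun i =>
    (G.symm.toLinearMap ∘ₗ LinearMap.inr R _ _ ∘ₗ LinearMap.single R Q i).codRestrict _ (by
      intro x
      rw [Submodule.mem_torsion_iff]
      refine ⟨⟨q i, mem_nonZeroDivisors_of_ne_zero (hq i)⟩, ?_⟩
      change q i • (G.symm.toLinearMap ∘ₗ LinearMap.inr R _ _ ∘ₗ LinearMap.single R Q i) x = 0
      rw [← map_smul, htor, map_zero])
  have hsG : ∀ i x, (s i x).1 = G.symm (0, Pi.single i x) := fun i x => rfl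
  have hhs : ∀ i j x, h j (s i x) = Pi.single (M := Q) i x j := by
    intro i j x
    rw [hh, hsG, G.apply_symm_apply]
  have hfst : ∀ v : Submodule.torsion R M, (G v.1).1 = 0 := by
    rintro ⟨v, hv⟩
    rw [Submodule.mem_torsion_iff] at hv
    obtain ⟨a, ha⟩ := hv
    have ha' : (a : R) • v = 0 := ha
    have h1 : (a : R) • (G v).1 = 0 := by
      rw [← Prod.smul_fst, ← map_smul, ha', map_zero]; rfl
    exact (smul_eq_zero.1 h1).resolve_left (nonZeroDivisors.ne_zero a.2)
  have hsum : ∀ v, ∑ i, s i (h i v) = v := by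
    intro v
    apply Subtype.ext
    apply G.injective
    rw [AddSubmonoidClass.coe_finsetSum, map_sum]
    simp only [hsG, G.apply_symm_apply]
    apply Prod.ext
    · rw [Prod.fst_sum, hfst]; simp
    · rw [Prod.snd_sum]
      simp only [hh]
      exact Finset.univ_sum_single _
  let Φ : ((ι → R) →ₗ[R] R) →+ (Submodule.torsion R M →ₗ[k] k) :=
    { toFun := fun φ => ∑ i, l i ∘ₗ (Algebra.lsmul k k (Q i) (φ (Pi.single i 1))) ∘ₗ
        (h i).restrictScalars k
      map_zero' := by ext v; simp
      map_add' := fun φ ψ => by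
        ext v; simp [Finset.sum_add_distrib] }
  have hΦ : ∀ φ v, Φ φ v = ∑ i, l i (φ (Pi.single i 1) • h i v) := by
    intro φ v
    change (∑ i, l i ∘ₗ (Algebra.lsmul k k (Q i) (φ (Pi.single i 1))) ∘ₗ
        (h i).restrictScalars k) v = _
    rw [LinearMap.sum_apply]
    rfl
  have hΦs : ∀ φ i x, Φ φ (s i x) = l i (φ (Pi.single i 1) • x) := by
    intro φ i x
    rw [hΦ, Finset.sum_eq_single i]
    · rw [hhs, Pi.single_eq_same]
    · intro j _ hj
      rw [hhs, Pi.single_eq_of_ne hj, smul_zero, map_zero]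
    · simp
  have hΦsurj : Function.Surjective Φ := by
    intro f
    choose a ha using fun i => hs i (f ∘ₗ (s i).restrictScalars k)
    refine ⟨∑ i, a i • LinearMap.proj i, ?_⟩
    ext v
    have ha' : ∀ i x, f (s i x) = l i (a i • x) := ha
    conv_rhs => rw [← hsum v, map_sum]
    rw [hΦ]
    refine Finset.sum_congr rfl fun i _ => ?_
    rw [ha']
    congr 2
    rw [LinearMap.sum_apply, Finset.sum_eq_single i]
    · simp
    · intro j _ hj
      simp [hj]
    · simp
  have hΦker : Φ.ker = (LinearMap.range (LinearMap.lcomp R R d)).toAddSubgroup := by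
    ext φ
    rw [AddMonoidHom.mem_ker, Submodule.mem_toAddSubgroup]
    constructor
    · intro h0
      have hdvd : ∀ i, q i ∣ φ (Pi.single i 1) := by
        intro i
        apply hl
        intro x
        rw [← hΦs, h0]; rfl
      choose z hz using hdvd
      refine ⟨(∑ i, z i • LinearMap.proj i) ∘ₗ LinearMap.snd R _ _, ?_⟩
      refine LinearMap.pi_ext' fun i => LinearMap.ext_ring ?_
      change (∑ j, z j • (LinearMap.proj j : (ι → R) →ₗ[R] R)) (d (Pi.single i 1)).2 = φ (Pi.single i 1)
      rw [LinearMap.sum_apply, Finset.sum_eq_single i]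
      · simp [hd2, hz, mul_comm]
      · intro j _ hj
        simp [hd2, hj]
      · simp
    · rintro ⟨g, rfl⟩
      ext v
      rw [hΦ]
      refine Finset.sum_eq_zero fun i _ => ?_
      have : d (Pi.single i 1) = q i • (0, Pi.single i 1) := by
        apply Prod.ext
        · simp [hd1]
        · funext j
          rw [hd2]
          by_cases hj : j = i
          · subst hj; simp
          · simp [hj]
      rw [LinearMap.lcomp_apply, this, map_smul g, smul_eq_mul, mul_comm, mul_smul, htor, smul_zero,
        map_zero]
  let e1 : (((ι → R) →ₗ[R] R) ⧸ LinearMap.range (LinearMap.lcomp R R d)) ≃+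
      (Submodule.torsion R M →ₗ[k] k) :=
    (QuotientAddGroup.quotientAddEquivOfEq hΦker.symm).trans
      (QuotientAddGroup.quotientKerEquivOfSurjective Φ hΦsurj)
  have he1 : ∀ φ, e1 (Submodule.Quotient.mk φ) = Φ φ := fun φ => rfl
  have hΦsmul : ∀ (r : R) φ v, Φ (r • φ) v = Φ φ (r • v) := by
    intro r φ v
    rw [hΦ, hΦ]
    refine Finset.sum_congr rfl fun i _ => ?_
    rw [LinearMap.smul_apply, smul_eq_mul, mul_comm, mul_smul, map_smul (h i)]
  have key : ∀ (r : R) x v, e1 (e0 (r • x)) v = e1 (e0 x) (r • v) := by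
    intro r x v
    rw [map_smul]
    obtain ⟨φ, hφ⟩ := Submodule.Quotient.mk_surjective _ (e0 x)
    rw [← hφ, ← Submodule.Quotient.mk_smul, he1, he1, hΦsmul]
  refine ⟨e0.toAddEquiv.trans e1, fun c x => ?_, fun x v => key (T 1) x v⟩
  ext v
  refine (key (C c) x v).trans ?_
  rw [LinearMap.smul_apply, ← map_smul]
  congr 1
  have : (C c : R) = c • (1 : R) := by
    rw [LaurentPolynomial.smul_eq_C_mul, mul_one]
  rw [this, smul_assoc, one_smul]

/-- For `R = k[t,t⁻¹]` and a finitely generated `R`-module `M`,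
`Ext¹_R(M, R)` is isomorphic to the `k`-linear dual of `Tors_R M`, with `t`
acting on the dual by the (conjugated) transpose action. -/
theorem ext_one_iso_dual_of_torsion
    (k : Type) [Field k] (M : Type) [AddCommGroup M]
    [Module (LaurentPolynomial k) M] [Module k M]
    [IsScalarTower k (LaurentPolynomial k) M]
    [Module.Finite (LaurentPolynomial k) M] :
    ∃ e : ((Ext (LaurentPolynomial k) (ModuleCat (LaurentPolynomial k)) 1).obj
        (op (ModuleCat.of (LaurentPolynomial k) M))).obj
          (ModuleCat.of (LaurentPolynomial k) (LaurentPolynomial k)) ≃+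
        (↥(Submodule.torsion (LaurentPolynomial k) M) →ₗ[k] k),
      (∀ (c : k) (x), e ((C c : LaurentPolynomial k) • x) = c • e x) ∧
      (∀ (x) (v : ↥(Submodule.torsion (LaurentPolynomial k) M)),
        e ((T 1 : LaurentPolynomial k) • x) v
          = e x ((T 1 : LaurentPolynomial k) • v)) := by
  classical
  have := laurent_pid k
  obtain ⟨n, ι, _, p, hp, e, ⟨E⟩⟩ := Module.equiv_free_prod_directSum (LaurentPolynomial k) M
  choose l hl hs using fun i => exists_frob k (p i) (hp i) (e i)
  refine ext_one_aux k M n ι (fun i => k[T;T⁻¹] ⧸ (k[T;T⁻¹] ∙ p i ^ e i)) (fun i => p i ^ e i)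
    (fun i => pow_ne_zero _ (hp i).ne_zero) (fun i => Submodule.mkQ _)
    (fun i => Submodule.mkQ_surjective _) ?_ l hl hs
    (E ≪≫ₗ (LinearEquiv.refl _ _).prodCongr (DirectSum.linearEquivFunOnFintype _ _ _))
  intro i a
  rw [Submodule.mkQ_apply, Submodule.Quotient.mk_eq_zero]
  exact Ideal.mem_span_singleton
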